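/- (Refined convergence from a δ₀-close start; equation (A.tighter).) Let F : E → ℝ be differentiable and L-smooth with L > 0, let x̂ ∈ E be a global minimizer of F, and let σ > 0, δ > 0 be such that the local error bound holds: ‖x − x̂‖ ≤ σ·‖∇F(x)‖ for every x ∈ B(x̂, δ). Set μ = 1/(2Lσ²) and assume L·σ ≥ 1 (so that μ ≤ L/2 < L). Let δ₀ = min{δ, (μ/√(2(L − μ)L))·δ}. If x₀ ∈ B(x̂, δ₀), then for every k ∈ ℕ the gradient-descent iterate x_k with step size 1/L satisfies ‖x_k − x̂‖ ≤ (1 − μ/L)^{k/2}·δ. -/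

import Mathlib

open Metric

theorem le_of_sq_le_sq_aux {a b : ℝ} (h : a ^ 2 ≤ b ^ 2) (hb : 0 ≤ b) : a ≤ b :=
  (le_abs_self a).trans (abs_le_of_sq_le_sq h hb)

theorem descent_aux {n : ℕ} (F : EuclideanSpace ℝ (Fin n) → ℝ)
    (hF : Differentiable ℝ F) (L : ℝ)
    (hsmooth : ∀ x₁ x₂, ‖gradient F x₁ - gradient F x₂‖ ≤ L * ‖x₁ - x₂‖)
    (x v : EuclideanSpace ℝ (Fin n)) :
    F (x + v) ≤ F x + inner ℝ (gradient F x) v + L / 2 * ‖v‖ ^ 2 := by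
  let φ : ℝ → ℝ := fun t => F (x + t • v) - t * inner ℝ (gradient F x) v
    - t ^ 2 * (L / 2 * ‖v‖ ^ 2)
  have hd : ∀ t : ℝ, HasDerivAt φ (inner ℝ (gradient F (x + t • v)) v
      - inner ℝ (gradient F x) v - 2 * t * (L / 2 * ‖v‖ ^ 2)) t := by
    intro t
    have h1 : HasDerivAt (fun t : ℝ => x + t • v) v t := by
      simpa using ((hasDerivAt_id t).smul_const v).const_add x
    have h2 := (hF (x + t • v)).hasGradientAt.hasFDerivAt.comp_hasDerivAt t h1
    have h3 := (hasDerivAt_id t).mul_const (inner ℝ (gradient F x) v)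
    have h4 := (hasDerivAt_pow 2 t).mul_const (L / 2 * ‖v‖ ^ 2)
    have h5 := (h2.sub h3).sub h4
    have he : inner ℝ (gradient F (x + t • v)) v
        - inner ℝ (gradient F x) v - 2 * t * (L / 2 * ‖v‖ ^ 2) =
        ((InnerProductSpace.toDual ℝ (EuclideanSpace ℝ (Fin n))) (gradient F (x + t • v))) v -
        1 * inner ℝ (gradient F x) v - ((2 : ℕ) : ℝ) * t ^ (2 - 1) * (L / 2 * ‖v‖ ^ 2) := by
      simp
    rw [he]
    exact h5
  have hanti : AntitoneOn φ (Set.Icc 0 1) := by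
    apply antitoneOn_of_deriv_nonpos (convex_Icc 0 1)
    · exact fun t _ => (hd t).continuousAt.continuousWithinAt
    · exact fun t _ => (hd t).differentiableAt.differentiableWithinAt
    · intro t ht
      rw [interior_Icc] at ht
      rw [(hd t).deriv, ← inner_sub_left]
      have h1 := real_inner_le_norm (gradient F (x + t • v) - gradient F x) v
      have h2 := hsmooth (x + t • v) x
      rw [add_sub_cancel_left, norm_smul, Real.norm_of_nonneg ht.1.le] at h2
      have h3 := mul_le_mul_of_nonneg_right h2 (norm_nonneg v)
      nlinarith
  have h := hanti (Set.left_mem_Icc.2 zero_le_one) (Set.right_mem_Icc.2 zero_le_one) zero_le_one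
  simp only [φ, zero_smul, one_smul, add_zero] at h
  linarith

/-- Equation (A.tighter): starting in the small ball `B(x̂, δ₀)`, the
gradient-descent iterates satisfy `‖x_k − x̂‖ ≤ (1 − μ/L)^{k/2}·δ`. -/
theorem refined_convergence_from_delta0
    (n : ℕ) (F : EuclideanSpace ℝ (Fin n) → ℝ)
    (hF : Differentiable ℝ F)
    (L : ℝ) (hL : 0 < L)
    (hsmooth : ∀ x₁ x₂, ‖gradient F x₁ - gradient F x₂‖ ≤ L * ‖x₁ - x₂‖)
    (xhat : EuclideanSpace ℝ (Fin n))
    (hmin : ∀ x, F xhat ≤ F x)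
    (σ δ : ℝ) (hσ : 0 < σ) (hδ : 0 < δ)
    (herr : ∀ x ∈ closedBall xhat δ, ‖x - xhat‖ ≤ σ * ‖gradient F x‖)
    (μ : ℝ) (hμ : μ = 1 / (2 * L * σ ^ 2))
    (hLσ : 1 ≤ L * σ)
    (δ₀ : ℝ) (hδ₀ : δ₀ = min δ (μ / Real.sqrt (2 * (L - μ) * L) * δ))
    (x : ℕ → EuclideanSpace ℝ (Fin n))
    (hiter : ∀ j : ℕ, x (j + 1) = x j - (1 / L) • gradient F (x j))
    (hx0 : x 0 ∈ closedBall xhat δ₀) :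
    ∀ k : ℕ, ‖x k - xhat‖ ≤ (1 - μ / L) ^ ((k : ℝ) / 2) * δ := by
  have hμ0 : 0 < μ := by rw [hμ]; positivity
  have hμσ : 2 * L * σ ^ 2 * μ = 1 := by rw [hμ]; field_simp
  have hμL : 2 * μ ≤ L := by
    have h1 : 1 ≤ (L * σ) ^ 2 := one_le_pow₀ hLσ
    have h2 : μ * 1 ≤ μ * (L * σ) ^ 2 := mul_le_mul_of_nonneg_left h1 hμ0.le
    have h3 : μ * (L * σ) ^ 2 = L / 2 := by linear_combination (L / 2) * hμσ
    linarith
  have hq0 : 0 ≤ 1 - μ / L := by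
    have : μ / L ≤ 1 := (div_le_one hL).2 (by linarith)
    linarith
  have hq1 : 1 - μ / L ≤ 1 := by
    have : 0 < μ / L := by positivity
    linarith
  have hg0 : gradient F xhat = 0 := by
    have : IsLocalMin F xhat := Filter.Eventually.of_forall hmin
    simp [gradient, this.fderiv_eq_zero]
  have hgle : ∀ y, ‖gradient F y‖ ≤ L * ‖y - xhat‖ := by
    intro y
    simpa [hg0] using hsmooth y xhat
  have hdesc : ∀ y, F (y - (1 / L) • gradient F y) ≤ F y - ‖gradient F y‖ ^ 2 / (2 * L) := by
    intro y
    have h := descent_aux F hF L hsmooth y (-((1 / L) • gradient F y))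
    rw [← sub_eq_add_neg, inner_neg_right, real_inner_smul_right, real_inner_self_eq_norm_sq,
      norm_neg, norm_smul, Real.norm_of_nonneg (by positivity)] at h
    refine h.trans (le_of_eq ?_)
    field_simp
    ring
  have hglow : ∀ y, ‖gradient F y‖ ^ 2 ≤ 2 * L * (F y - F xhat) := by
    intro y
    have h1 := (hmin _).trans (hdesc y)
    have h2 : ‖gradient F y‖ ^ 2 / (2 * L) ≤ F y - F xhat := by linarith
    rw [div_le_iff₀ (by positivity)] at h2
    linarith
  have hup : ∀ y, F y - F xhat ≤ L / 2 * ‖y - xhat‖ ^ 2 := by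
    intro y
    have h := descent_aux F hF L hsmooth xhat (y - xhat)
    rw [hg0, inner_zero_left, add_sub_cancel] at h
    linarith
  have herr2 : ∀ y, ‖y - xhat‖ ≤ δ → 2 * L * μ * ‖y - xhat‖ ^ 2 ≤ ‖gradient F y‖ ^ 2 := by
    intro y hy
    have h := herr y (by simpa [dist_eq_norm] using hy)
    have h2 : ‖y - xhat‖ ^ 2 ≤ (σ * ‖gradient F y‖) ^ 2 :=
      pow_le_pow_left₀ (norm_nonneg _) h 2
    calc 2 * L * μ * ‖y - xhat‖ ^ 2 ≤ 2 * L * μ * (σ * ‖gradient F y‖) ^ 2 := by gcongr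
      _ = ‖gradient F y‖ ^ 2 := by linear_combination ‖gradient F y‖ ^ 2 * hμσ
  have hqg : ∀ y, ‖y - xhat‖ ≤ δ → μ * ‖y - xhat‖ ^ 2 ≤ F y - F xhat := by
    intro y hy
    have h1 := (herr2 y hy).trans (hglow y)
    have : 2 * L * (μ * ‖y - xhat‖ ^ 2) ≤ 2 * L * (F y - F xhat) := by linarith
    exact le_of_mul_le_mul_left this (by positivity)
  have hx0' : ‖x 0 - xhat‖ ≤ δ₀ := by simpa [dist_eq_norm] using hx0
  have hd0 : ‖x 0 - xhat‖ ≤ δ := hx0'.trans (hδ₀ ▸ min_le_left _ _)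
  have hs : 0 < 2 * (L - μ) * L := by
    have : 0 < L - μ := by linarith
    positivity
  have hF0 : F (x 0) - F xhat ≤ μ * (δ ^ 2 / 4) := by
    have h1 : ‖x 0 - xhat‖ ≤ μ / Real.sqrt (2 * (L - μ) * L) * δ :=
      hx0'.trans (hδ₀ ▸ min_le_right _ _)
    have h2 := pow_le_pow_left₀ (norm_nonneg _) h1 2
    rw [mul_pow, div_pow, Real.sq_sqrt hs.le] at h2
    have h3 : μ ^ 2 / (2 * (L - μ) * L) ≤ μ / (2 * L) := by
      rw [div_le_div_iff₀ hs (by positivity)]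
      nlinarith [mul_nonneg (mul_nonneg hμ0.le hL.le) (sub_nonneg.2 hμL)]
    have h4 : μ ^ 2 / (2 * (L - μ) * L) * δ ^ 2 ≤ μ / (2 * L) * δ ^ 2 := by gcongr
    calc F (x 0) - F xhat ≤ L / 2 * ‖x 0 - xhat‖ ^ 2 := hup _
      _ ≤ L / 2 * (μ / (2 * L) * δ ^ 2) := by
        have := h2.trans h4
        gcongr
      _ = μ * (δ ^ 2 / 4) := by field_simp; norm_num
  have hhalf : ∀ k, ‖x k - xhat‖ ≤ δ →
      F (x k) - F xhat ≤ (1 - μ / L) ^ k * (μ * (δ ^ 2 / 4)) →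
      ‖x k - xhat‖ ^ 2 ≤ (1 - μ / L) ^ k * (δ / 2) ^ 2 := by
    intro k h1 h2
    have h3 := (hqg _ h1).trans h2
    have : μ * ‖x k - xhat‖ ^ 2 ≤ μ * ((1 - μ / L) ^ k * (δ / 2) ^ 2) := by linarith
    exact le_of_mul_le_mul_left this hμ0
  have main : ∀ k, ‖x k - xhat‖ ≤ δ ∧
      F (x k) - F xhat ≤ (1 - μ / L) ^ k * (μ * (δ ^ 2 / 4)) := by
    intro k
    induction k with
    | zero => exact ⟨hd0, by simpa using hF0⟩
    | succ k ih =>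
      obtain ⟨h1, h2⟩ := ih
      constructor
      · have h3 := hhalf k h1 h2
        have h4 : ‖x k - xhat‖ ^ 2 ≤ (δ / 2) ^ 2 :=
          h3.trans (mul_le_of_le_one_left (by positivity) (pow_le_one₀ hq0 hq1))
        have h5 : ‖x k - xhat‖ ≤ δ / 2 := le_of_sq_le_sq_aux h4 (by positivity)
        have h6 : ‖(1 / L) • gradient F (x k)‖ ≤ ‖x k - xhat‖ := by
          rw [norm_smul, Real.norm_of_nonneg (by positivity), one_div_mul_eq_div,
            div_le_iff₀ hL]
          linarith [hgle (x k)]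
        have h7 := norm_sub_le (x k - xhat) ((1 / L) • gradient F (x k))
        rw [hiter, sub_right_comm]
        linarith
      · have h3 := hdesc (x k)
        rw [← hiter] at h3
        have h4 := herr2 _ h1
        have h5 : μ / L * (F (x k) - F xhat) ≤ ‖gradient F (x k)‖ ^ 2 / (2 * L) := by
          calc μ / L * (F (x k) - F xhat) ≤ μ / L * (L / 2 * ‖x k - xhat‖ ^ 2) := by
                gcongr; exact hup _
            _ = μ / 2 * ‖x k - xhat‖ ^ 2 := by field_simp
            _ ≤ μ * ‖x k - xhat‖ ^ 2 := by gcongr; linarith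
            _ = 2 * L * μ * ‖x k - xhat‖ ^ 2 / (2 * L) := by field_simp
            _ ≤ _ := by gcongr
        have h6 := mul_le_mul_of_nonneg_left h2 hq0
        rw [pow_succ]
        linarith
  intro k
  obtain ⟨h1, h2⟩ := main k
  have h3 := hhalf k h1 h2
  have hr : ((1 - μ / L) ^ ((k : ℝ) / 2)) ^ 2 = (1 - μ / L) ^ k := by
    rw [← Real.rpow_natCast, ← Real.rpow_mul hq0, ← Real.rpow_natCast]
    congr 1
    push_cast
    ring
  have hrn : 0 ≤ (1 - μ / L) ^ ((k : ℝ) / 2) := Real.rpow_nonneg hq0 _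
  apply le_of_sq_le_sq_aux _ (by positivity)
  rw [mul_pow, hr]
  refine h3.trans ?_
  have : 0 ≤ (1 - μ / L) ^ k := pow_nonneg hq0 k
  gcongr
  linarith
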